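/- Let β ∈ F and let Φ be a β-recurrent CH system on V with associated scalars {ϑ_i}_{i=0}^{d+1}. Then for 1 ≤ i ≤ d the following hold. (i) If β ≠ 2 and β ≠ −2, and q is a nonzero element of the algebraic closure of F with q + q^{−1} = β, then ϑ_i = [(q^i−1)(q^{d−i}−1)/((q−1)(q^{d−1}−1))]·ϑ_1 + [(q^{i−1}−1)(q^{d−i+1}−1)/((q−1)(q^{d−1}−1))]·ϑ_d. (ii) If β = 2 and char F ≠ 2, then ϑ_i = [i(d−i)/(d−1)]·ϑ_1 + [(i−1)(d−i+1)/(d−1)]·ϑ_d. (iii) If β = −2, char F ≠ 2, and d is odd, then ϑ_i = [i/(d−1)]·ϑ_1 + [(d−i+1)/(d−1)]·ϑ_d when i is even, and ϑ_i = [(d−i)/(d−1)]·ϑ_1 + [(i−1)/(d−1)]·ϑ_d when i is odd. (iv) If β = 0, char F = 2, and d = 3, then ϑ_2 = ϑ_1 + ϑ_3. -/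

import Mathlib

open Polynomial Finset Module

variable {F V : Type*} [Field F] [AddCommGroup V] [Module F V]

/-- The primitive idempotent of `A` for the eigenvalue `θ i`, where the eigenvalues of `A`
are `θ 0, …, θ d`. -/
noncomputable def primIdem (d : ℕ) (A : Module.End F V) (θ : ℕ → F) (i : ℕ) :
    Module.End F V :=
  Polynomial.aeval A (∏ j ∈ (Finset.range (d+1)).erase i,
    (Polynomial.C (θ i - θ j)⁻¹ * (Polynomial.X - Polynomial.C (θ j))))

/-- A sequence `σ 0, …, σ n` is `β`-recurrent. -/
def BetaRecurrent (β : F) (n : ℕ) (σ : ℕ → F) : Prop :=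
  ∀ i, 2 ≤ i → i + 1 ≤ n → σ (i-2) - (β+1) * σ (i-1) + (β+1) * σ i - σ (i+1) = 0

/-- The scalars ϑ_i attached to eigenvalue data `θ, θs` and a split sequence `φ`:
`ϑ 0 = 0`, `ϑ (d+1) = 0` and `ϑ i = φ i - (θs i - θs 0)(θ (d-i+1) - θ 0)` for `1 ≤ i ≤ d`. -/
def vth (d : ℕ) (θ θs φ : ℕ → F) (i : ℕ) : F :=
  if 1 ≤ i ∧ i ≤ d then φ i - (θs i - θs 0) * (θ (d - i + 1) - θ 0) else 0

/-- `φ 1, …, φ d` is the split sequence for `(A, As)` with eigenvalue data `θ, θs`: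
there is a (split) basis `v 0, …, v d` of `V` on which `A, As` act in the prescribed way. -/
def SplitSeq (d : ℕ) (A As : Module.End F V) (θ θs φ : ℕ → F) : Prop :=
  ∃ v : ℕ → V,
    LinearIndependent F (fun i : Fin (d+1) => v i) ∧
    Submodule.span F (v '' Set.Iic d) = ⊤ ∧
    (∀ i < d, A (v i) = θ (d - i) • v i + v (i+1)) ∧
    A (v d) = θ 0 • v d ∧
    As (v 0) = θs 0 • v 0 ∧
    (∀ i, 1 ≤ i → i ≤ d → As (v i) = θs i • v i + φ i • v (i-1))

/-- A circular Hessenberg system on `V` of diameter `d`. -/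
structure CHSystem (F V : Type*) [Field F] [AddCommGroup V] [Module F V] (d : ℕ) where
  A : Module.End F V
  As : Module.End F V
  θ : ℕ → F
  θs : ℕ → F
  θ_inj : ∀ i ≤ d, ∀ j ≤ d, θ i = θ j → i = j
  θs_inj : ∀ i ≤ d, ∀ j ≤ d, θs i = θs j → i = j
  A_ann : Polynomial.aeval A (∏ j ∈ Finset.range (d+1), (Polynomial.X - Polynomial.C (θ j))) = 0
  As_ann : Polynomial.aeval As (∏ j ∈ Finset.range (d+1), (Polynomial.X - Polynomial.C (θs j))) = 0
  A_eig : ∀ i ≤ d, Module.End.HasEigenvalue A (θ i)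
  As_eig : ∀ i ≤ d, Module.End.HasEigenvalue As (θs i)
  circ₁ : ∀ i ≤ d, ∀ j ≤ d, ((j:ℤ) + 1 < (i:ℤ) ∨ (1 < (j:ℤ) - (i:ℤ) ∧ (j:ℤ) - (i:ℤ) < (d:ℤ))) →
      primIdem d A θ i * As * primIdem d A θ j = 0
  circ₂ : ∀ i ≤ d, ∀ j ≤ d, ((i:ℤ) = (j:ℤ) + 1 ∨ (j:ℤ) = (i:ℤ) + (d:ℤ)) →
      primIdem d A θ i * As * primIdem d A θ j ≠ 0
  circ₃ : ∀ i ≤ d, ∀ j ≤ d, ((j:ℤ) + 1 < (i:ℤ) ∨ (1 < (j:ℤ) - (i:ℤ) ∧ (j:ℤ) - (i:ℤ) < (d:ℤ))) →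
      primIdem d As θs i * A * primIdem d As θs j = 0
  circ₄ : ∀ i ≤ d, ∀ j ≤ d, ((i:ℤ) = (j:ℤ) + 1 ∨ (j:ℤ) = (i:ℤ) + (d:ℤ)) →
      primIdem d As θs i * A * primIdem d As θs j ≠ 0

section Idempotents

variable {d : ℕ} {A : Module.End F V} {θ : ℕ → F}

theorem primIdem_eq_aeval_basis (i : ℕ) :
    primIdem d A θ i = aeval A (Lagrange.basis (range (d + 1)) θ i) := rfl

theorem sum_primIdem (hθ : ∀ i ≤ d, ∀ j ≤ d, θ i = θ j → i = j) :
    ∑ i ∈ range (d + 1), primIdem d A θ i = 1 := by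
  have hinj : Set.InjOn θ (range (d + 1)) := by
    intro i hi j hj h
    simp only [coe_range, Set.mem_Iio] at hi hj
    exact hθ i (by omega) j (by omega) h
  simp_rw [primIdem_eq_aeval_basis]
  rw [← map_sum, Lagrange.sum_basis hinj ⟨0, by simp⟩, map_one]

theorem mul_primIdem
    (hA : aeval A (∏ j ∈ range (d + 1), (X - C (θ j))) = 0) {i : ℕ} (hi : i ≤ d) :
    A * primIdem d A θ i = θ i • primIdem d A θ i := by
  have h : (X - C (θ i)) * Lagrange.basis (range (d + 1)) θ i =
      (∏ j ∈ (range (d + 1)).erase i, C (θ i - θ j)⁻¹) *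
        ∏ j ∈ range (d + 1), (X - C (θ j)) := by
    rw [← mul_prod_erase (range (d + 1)) _ (mem_range.2 (Nat.lt_succ_of_le hi))]
    simp only [Lagrange.basis, Lagrange.basisDivisor, prod_mul_distrib]
    ring
  have h' := congrArg (aeval A) h
  rw [map_mul, map_mul, hA, mul_zero, map_sub, aeval_X, aeval_C, sub_mul,
    ← primIdem_eq_aeval_basis, sub_eq_zero, Algebra.algebraMap_eq_smul_one, smul_mul_assoc,
    one_mul] at h'
  exact h'

theorem primIdem_mul
    (hA : aeval A (∏ j ∈ range (d + 1), (X - C (θ j))) = 0) {i : ℕ} (hi : i ≤ d) :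
    primIdem d A θ i * A = θ i • primIdem d A θ i := by
  rw [← mul_primIdem hA hi, primIdem_eq_aeval_basis]
  nth_rewrite 2 [← aeval_X (R := F) A]
  nth_rewrite 3 [← aeval_X (R := F) A]
  rw [← map_mul, ← map_mul, mul_comm]

/-- The idempotent of `θ d` kills every split basis vector except the first one. -/
theorem primIdem_apply_split {v : ℕ → V} (hv : ∀ i < d, A (v i) = θ (d - i) • v i + v (i + 1))
    (hvd : A (v d) = θ 0 • v d) {i : ℕ} (hi1 : 1 ≤ i) (hid : i ≤ d) :
    primIdem d A θ d (v i) = 0 := by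
  have key : ∀ k ≤ d, aeval A (∏ j ∈ range (k + 1), (X - C (θ j))) (v (d - k)) = 0 := by
    intro k
    induction k with
    | zero => intro _; simp [hvd]
    | succ k ih =>
      intro hk
      rw [prod_range_succ, map_mul, Module.End.mul_apply, map_sub, aeval_X, aeval_C,
        LinearMap.sub_apply, Module.algebraMap_end_apply, hv _ (by omega),
        show d - (d - (k + 1)) = k + 1 by omega, show d - (k + 1) + 1 = d - k by omega,
        add_sub_cancel_left]
      exact ih (by omega)
  obtain ⟨m, hm⟩ : ∃ m, d = m + i := ⟨d - i, by omega⟩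
  have hsub : range (m + 1) ⊆ (range (d + 1)).erase d := by
    intro j hj
    simp only [mem_range, mem_erase] at hj ⊢
    omega
  have hk := key m (by omega)
  rw [show d - m = i by omega] at hk
  rw [primIdem, ← prod_sdiff hsub]
  simp only [prod_mul_distrib, map_mul, Module.End.mul_apply, hk, map_zero]

end Idempotents

/-- The tridiagonal relation: `A³B - (β+1)A²BA + (β+1)ABA² - BA³ - γ(A²B - BA²) - ρ(AB - BA)`. -/
def tdExpr (β γ ρ : F) (A B : Module.End F V) : Module.End F V :=
  A * (A * (A * B)) - (β + 1) • (A * (A * (B * A))) + (β + 1) • (A * (B * (A * A)))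
    - B * (A * (A * A)) - γ • (A * (A * B) - B * (A * A)) - ρ • (A * B - B * A)

theorem mul_tdExpr_mul (β γ ρ : F) {A B E E' : Module.End F V} {x y : F}
    (hE : E * A = x • E) (hE' : A * E' = y • E') :
    E * tdExpr β γ ρ A B * E' =
      ((x - y) * (x ^ 2 - β * (x * y) + y ^ 2 - γ * (x + y) - ρ)) • (E * B * E') := by
  have hl : ∀ Y, E * (A * Y) = x • (E * Y) := fun Y => by
    rw [← mul_assoc, hE, smul_mul_assoc]
  simp only [tdExpr, mul_sub, mul_add, sub_mul, add_mul, mul_smul_comm, smul_mul_assoc,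
    mul_assoc, hl, hE', smul_smul]
  module

section Recurrence

variable {β : F} {n : ℕ} {σ : ℕ → F}

theorem BetaRecurrent.gamma_const (h : BetaRecurrent β n σ) :
    ∀ i, i + 2 ≤ n → σ i - β * σ (i + 1) + σ (i + 2) = σ 0 - β * σ 1 + σ 2 := by
  intro i
  induction i with
  | zero => intro _; rfl
  | succ i ih =>
    intro hi
    have h1 := h (i + 2) (by omega) (by omega)
    simp only [Nat.add_sub_cancel, show i + 2 - 1 = i + 1 by omega] at h1
    rw [← ih (by omega)]
    linear_combination -h1

theorem BetaRecurrent.rho_const (h : BetaRecurrent β n σ) :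
    ∀ i, i + 1 ≤ n → σ i ^ 2 - β * (σ i * σ (i + 1)) + σ (i + 1) ^ 2
        - (σ 0 - β * σ 1 + σ 2) * (σ i + σ (i + 1)) =
      σ 0 ^ 2 - β * (σ 0 * σ 1) + σ 1 ^ 2 - (σ 0 - β * σ 1 + σ 2) * (σ 0 + σ 1) := by
  intro i
  induction i with
  | zero => intro _; rfl
  | succ i ih =>
    intro hi
    have h1 := h.gamma_const i (by omega)
    rw [← ih (by omega), show i + 1 + 1 = i + 2 by omega]
    linear_combination (σ (i + 2) - σ i) * h1

/-- A recurrent sequence is determined by its first three terms. -/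
theorem BetaRecurrent.eq_of_init {τ : ℕ → F} (h : BetaRecurrent β n σ)
    (hτ : ∀ i, τ i - (β + 1) * τ (i + 1) + (β + 1) * τ (i + 2) - τ (i + 3) = 0)
    (h0 : σ 0 = τ 0) (h1 : σ 1 = τ 1) (h2 : σ 2 = τ 2) : ∀ i ≤ n, σ i = τ i := by
  intro i
  induction i using Nat.strong_induction_on with
  | _ i ih =>
    intro hi
    match i, ih, hi with
    | 0, _, _ => exact h0
    | 1, _, _ => exact h1
    | 2, _, _ => exact h2
    | i + 3, ih, hi =>
      have e := h (i + 2) (by omega) (by omega)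
      simp only [Nat.add_sub_cancel, show i + 2 - 1 = i + 1 by omega,
        show i + 2 + 1 = i + 3 by omega] at e
      rw [ih i (by omega) (by omega), ih (i + 1) (by omega) (by omega),
        ih (i + 2) (by omega) (by omega)] at e
      linear_combination hτ i - e

theorem BetaRecurrent.map {K : Type*} [Field K] (f : F →+* K) (h : BetaRecurrent β n σ) :
    BetaRecurrent (f β) n (fun i => f (σ i)) := by
  intro i hi hi'
  simpa using congrArg f (h i hi hi')

theorem BetaRecurrent.exists_geometric {q : F} (hq : q ≠ 0) (hq2 : q ^ 2 ≠ 1)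
    (hβ : q + q⁻¹ = β) (h : BetaRecurrent β n σ) :
    ∃ a b c : F, ∀ i ≤ n, σ i = a + b * q ^ i + c * (q⁻¹) ^ i := by
  have hq1 : q - 1 ≠ 0 := fun e => hq2 (by linear_combination (q + 1) * e)
  have hq2' : q ^ 2 - 1 ≠ 0 := sub_ne_zero.2 hq2
  refine ⟨σ 0 - (q * (σ 2 - σ 1) - (σ 1 - σ 0)) / ((q ^ 2 - 1) * (q - 1))
      - q ^ 2 * (σ 2 - σ 1 - q * (σ 1 - σ 0)) / ((q ^ 2 - 1) * (q - 1)),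
    (q * (σ 2 - σ 1) - (σ 1 - σ 0)) / ((q ^ 2 - 1) * (q - 1)),
    q ^ 2 * (σ 2 - σ 1 - q * (σ 1 - σ 0)) / ((q ^ 2 - 1) * (q - 1)),
    h.eq_of_init ?_ ?_ ?_ ?_⟩
  · intro i
    rw [← hβ]
    simp only [pow_add]
    generalize q ^ i = x, q⁻¹ ^ i = y
    field_simp
    ring
  · simp only [pow_zero]
    ring
  · field_simp
    ring
  · field_simp
    ring

theorem BetaRecurrent.exists_quadratic (h2 : (2 : F) ≠ 0) (h : BetaRecurrent (2 : F) n σ) :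
    ∃ a b c : F, ∀ i ≤ n, σ i = a + b * i + c * (i : F) ^ 2 := by
  refine ⟨σ 0, (σ 1 - σ 0) - (σ 2 - 2 * σ 1 + σ 0) / 2, (σ 2 - 2 * σ 1 + σ 0) / 2,
    h.eq_of_init ?_ ?_ ?_ ?_⟩
  · intro i
    push_cast
    ring
  · simp
  · push_cast
    ring
  · push_cast
    field_simp
    ring

theorem BetaRecurrent.exists_alternating (h2 : (2 : F) ≠ 0) (h : BetaRecurrent (-2 : F) n σ) :
    ∃ a b c : F, ∀ i ≤ n, σ i = a + (-1) ^ i * (b + c * i) := by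
  refine ⟨σ 0 - (σ 0 - σ 1 - (σ 2 - σ 0) / 2) / 2, (σ 0 - σ 1 - (σ 2 - σ 0) / 2) / 2,
    (σ 2 - σ 0) / 2,
    h.eq_of_init ?_ ?_ ?_ ?_⟩
  · intro i
    push_cast
    ring
  · push_cast
    ring
  · push_cast
    field_simp
    ring
  · push_cast
    field_simp
    ring

end Recurrence

namespace CHSystem

variable {d : ℕ}

/-- The tridiagonal expression of a circular Hessenberg system with recurrent eigenvalues is
concentrated in the corner `(0, d)`. -/
theorem tdExpr_eq_corner (hd : 3 ≤ d) {β : F} (Φ : CHSystem F V d)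
    (hθ : BetaRecurrent β d Φ.θ) {γ ρ : F} (hγ : γ = Φ.θ 0 - β * Φ.θ 1 + Φ.θ 2)
    (hρ : ρ = Φ.θ 0 ^ 2 - β * (Φ.θ 0 * Φ.θ 1) + Φ.θ 1 ^ 2 - γ * (Φ.θ 0 + Φ.θ 1)) :
    tdExpr β γ ρ Φ.A Φ.As =
      ((Φ.θ 0 - Φ.θ d) * (Φ.θ 0 ^ 2 - β * (Φ.θ 0 * Φ.θ d) + Φ.θ d ^ 2
        - γ * (Φ.θ 0 + Φ.θ d) - ρ)) •
        (primIdem d Φ.A Φ.θ 0 * Φ.As * primIdem d Φ.A Φ.θ d) := by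
  have entry : ∀ i ≤ d, ∀ j ≤ d, _ := fun i hi j hj =>
    mul_tdExpr_mul β γ ρ (B := Φ.As) (primIdem_mul Φ.A_ann hi) (mul_primIdem Φ.A_ann hj)
  have zero_entry : ∀ i ≤ d, ∀ j ≤ d, ¬ (i = 0 ∧ j = d) →
      primIdem d Φ.A Φ.θ i * tdExpr β γ ρ Φ.A Φ.As * primIdem d Φ.A Φ.θ j = 0 := by
    intro i hi j hj hij
    rw [entry i hi j hj]
    have hc := hθ.rho_const
    rw [← hγ, ← hρ] at hc
    by_cases h1 : j + 1 < i ∨ i + 1 < j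
    · rw [Φ.circ₁ i hi j hj (by omega), smul_zero]
    · obtain rfl | rfl | rfl : i = j ∨ j = i + 1 ∨ i = j + 1 := by omega
      · simp
      · rw [hc i hj, sub_self, mul_zero, zero_smul]
      · convert zero_smul F _
        linear_combination (Φ.θ (j + 1) - Φ.θ j) * hc j hi
  rw [← entry 0 (by omega) d le_rfl]
  conv_lhs => rw [← one_mul (tdExpr β γ ρ Φ.A Φ.As), ← mul_one (1 * tdExpr β γ ρ Φ.A Φ.As),
    ← sum_primIdem (A := Φ.A) Φ.θ_inj, sum_mul, sum_mul]
  rw [sum_eq_single 0, mul_sum, sum_eq_single d]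
  · intro j hj hjd
    exact zero_entry 0 (by omega) j (by simp at hj; omega) (by omega)
  · simp
  · intro i hi hi0
    rw [mul_sum]
    refine sum_eq_zero fun j hj => ?_
    simp only [mem_range] at hi hj
    exact zero_entry i (by omega) j (by omega) (by omega)
  · simp

/-- Recurrent eigenvalues of a circular Hessenberg system close up: extending the sequence by
`θ (d+1) = θ 0` keeps it recurrent. -/
theorem betaRecurrent_update (hd : 3 ≤ d) {β : F} (Φ : CHSystem F V d) {φ : ℕ → F}
    (hsplit : SplitSeq d Φ.A Φ.As Φ.θ Φ.θs φ) (hθ : BetaRecurrent β d Φ.θ)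
    (hθs : BetaRecurrent β d Φ.θs) :
    BetaRecurrent β (d + 1) (Function.update Φ.θ (d + 1) (Φ.θ 0)) := by
  obtain ⟨v, hli, hspan, hA, hAd, hAs0, hAs⟩ := hsplit
  obtain ⟨γ, hγ⟩ : ∃ γ, γ = Φ.θ 0 - β * Φ.θ 1 + Φ.θ 2 := ⟨_, rfl⟩
  obtain ⟨ρ, hρ⟩ : ∃ ρ, ρ = Φ.θ 0 ^ 2 - β * (Φ.θ 0 * Φ.θ 1) + Φ.θ 1 ^ 2
    - γ * (Φ.θ 0 + Φ.θ 1) := ⟨_, rfl⟩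
  have hX := Φ.tdExpr_eq_corner hd hθ hγ hρ
  set c := (Φ.θ 0 - Φ.θ d) * (Φ.θ 0 ^ 2 - β * (Φ.θ 0 * Φ.θ d) + Φ.θ d ^ 2
        - γ * (Φ.θ 0 + Φ.θ d) - ρ) with hc
  have hcorner : (primIdem d Φ.A Φ.θ 0 * Φ.As * primIdem d Φ.A Φ.θ d) (v 0) ≠ 0 := by
    intro h0
    refine Φ.circ₂ 0 (by omega) d le_rfl (by omega) (LinearMap.ext_on hspan ?_)
    rintro _ ⟨i, hi, rfl⟩
    rcases Nat.eq_zero_or_pos i with rfl | hpos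
    · exact h0
    · rw [Module.End.mul_apply, primIdem_apply_split hA hAd hpos hi, map_zero,
        LinearMap.zero_apply]
  have heig : Φ.A (tdExpr β γ ρ Φ.A Φ.As (v 0)) = Φ.θ 0 • tdExpr β γ ρ Φ.A Φ.As (v 0) := by
    rw [← Module.End.mul_apply, hX, mul_smul_comm, ← mul_assoc, ← mul_assoc,
      mul_primIdem Φ.A_ann (by omega : 0 ≤ d), smul_mul_assoc, smul_mul_assoc, smul_comm,
      LinearMap.smul_apply]
  have hA0 := hA 0 (by omega)
  have hA1 := hA 1 (by omega)
  have hA2 := hA 2 (by omega)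
  have hAs1 := hAs 1 (by omega) (by omega)
  have hAs2 := hAs 2 (by omega) (by omega)
  have hAs3 := hAs 3 (by omega) (by omega)
  simp only [Nat.sub_zero, zero_add, Nat.reduceAdd, Nat.reduceSub] at hA0 hA1 hA2 hAs1 hAs2 hAs3
  have hrec := hθs 2 le_rfl (by omega)
  simp only [Nat.reduceAdd, Nat.reduceSub] at hrec
  obtain ⟨y0, y1, y2, hy⟩ : ∃ y0 y1 y2 : F,
      tdExpr β γ ρ Φ.A Φ.As (v 0) = y0 • v 0 + y1 • v 1 + y2 • v 2 := by
    generalize Φ.θ d = t0 at hA0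
    generalize Φ.θ (d - 1) = t1 at hA1
    generalize Φ.θ (d - 2) = t2 at hA2
    set u := Φ.θs
    refine ⟨
      u 0 * t0 ^ 3 - (β + 1) * ((t0 * u 0 + φ 1) * t0 ^ 2)
        + (β + 1) * ((t0 ^ 2 * u 0 + (t0 + t1) * φ 1) * t0)
        - (t0 ^ 3 * u 0 + (t0 ^ 2 + t0 * t1 + t1 ^ 2) * φ 1)
        - γ * (u 0 * t0 ^ 2 - (t0 ^ 2 * u 0 + (t0 + t1) * φ 1))
        - ρ * (u 0 * t0 - (t0 * u 0 + φ 1)),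
      u 0 * (t0 ^ 2 + t0 * t1 + t1 ^ 2)
        - (β + 1) * ((t0 * u 0 + φ 1) * (t0 + t1) + u 1 * t1 ^ 2)
        + (β + 1) * (t0 ^ 2 * u 0 + (t0 + t1) * φ 1 + ((t0 + t1) * u 1 + φ 2) * t1)
        - ((t0 ^ 2 + t0 * t1 + t1 ^ 2) * u 1 + (t0 + t1 + t2) * φ 2)
        - γ * (u 0 * (t0 + t1) - ((t0 + t1) * u 1 + φ 2)) - ρ * (u 0 - u 1),
      u 0 * (t0 + t1 + t2) - (β + 1) * (t0 * u 0 + φ 1 + u 1 * t1 + u 1 * t2)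
        + (β + 1) * ((t0 + t1) * u 1 + φ 2 + u 2 * t2)
        - ((t0 + t1 + t2) * u 2 + φ 3) - γ * (u 0 - u 2), ?_⟩
    rw [← add_zero (_ + _ + _), ← zero_smul F (v 3), ← hrec]
    simp only [tdExpr, LinearMap.sub_apply, LinearMap.add_apply, LinearMap.smul_apply,
      Module.End.mul_apply, map_add, map_smul, hA0, hA1, hA2, hAs0, hAs1, hAs2, hAs3]
    module
  have hy0 : y0 = 0 ∧ y1 = 0 ∧ y2 = 0 := by
    rw [hy] at heig
    simp only [map_add, map_smul, hA0, hA1, hA2] at heig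
    have hli4 : LinearIndependent F (fun i : Fin 4 => v i) :=
      hli.comp (Fin.castLE (by omega : 4 ≤ d + 1)) (Fin.castLE_injective _)
    rw [Fintype.linearIndependent_iff] at hli4
    have hz := hli4 ![y0 * (Φ.θ d - Φ.θ 0), y0 + y1 * (Φ.θ (d - 1) - Φ.θ 0),
      y1 + y2 * (Φ.θ (d - 2) - Φ.θ 0), y2] (by
        simp only [Fin.sum_univ_four, Matrix.cons_val]
        rw [← sub_eq_zero] at heig
        rw [← heig]
        simp only [Fin.isValue, Fin.coe_ofNat_eq_mod]
        module)
    have z0 := hz 0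
    have z1 := hz 1
    have z2 := hz 2
    have ne0 : Φ.θ d - Φ.θ 0 ≠ 0 :=
      fun h => by have := Φ.θ_inj d le_rfl 0 (by omega) (sub_eq_zero.1 h); omega
    have ne1 : Φ.θ (d - 1) - Φ.θ 0 ≠ 0 :=
      fun h => by have := Φ.θ_inj (d - 1) (by omega) 0 (by omega) (sub_eq_zero.1 h); omega
    have z3 := hz 3
    simp only [Matrix.cons_val] at z0 z1 z2 z3
    simp_all
  have hc0 : c = 0 := by
    rw [hX, hy0.1, hy0.2.1, hy0.2.2] at hy
    rw [zero_smul, zero_smul, zero_smul, add_zero, add_zero, LinearMap.smul_apply] at hy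
    exact (smul_eq_zero.1 hy).resolve_right hcorner
  obtain ⟨m, rfl⟩ : ∃ m, d = m + 2 := ⟨d - 2, by omega⟩
  have ne0 : Φ.θ 0 - Φ.θ (m + 2) ≠ 0 :=
    fun h => by have := Φ.θ_inj 0 (by omega) (m + 2) le_rfl (sub_eq_zero.1 h); omega
  have ne1 : Φ.θ 0 - Φ.θ (m + 1) ≠ 0 :=
    fun h => by have := Φ.θ_inj 0 (by omega) (m + 1) (by omega) (sub_eq_zero.1 h); omega
  have hclose : Φ.θ 0 + Φ.θ (m + 1) - β * Φ.θ (m + 2) - γ = 0 := by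
    have e1 := (mul_eq_zero.1 hc0).resolve_left ne0
    have e2 := hθ.rho_const (m + 1) (by omega)
    rw [← hγ, ← hρ] at e2
    refine (mul_eq_zero.1 ?_).resolve_left ne1
    linear_combination e1 - e2
  intro i hi hi'
  rcases Nat.lt_or_ge i (m + 2) with hlt | hge
  · have e := hθ i hi (by omega)
    simpa [Function.update_of_ne, show i - 2 ≠ m + 2 + 1 by omega,
      show i - 1 ≠ m + 2 + 1 by omega, show i ≠ m + 2 + 1 by omega,
      show i ≠ m + 2 by omega] using e
  · obtain rfl : i = m + 2 := by omega
    have e := hθ.gamma_const m le_rfl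
    simp only [Nat.add_sub_cancel, show m + 2 - 1 = m + 1 by omega, Function.update_self,
      Function.update_of_ne (show m ≠ m + 2 + 1 by omega),
      Function.update_of_ne (show m + 1 ≠ m + 2 + 1 by omega),
      Function.update_of_ne (show m + 2 ≠ m + 2 + 1 by omega)]
    linear_combination e - hclose - hγ

end CHSystem

section ClosedForms

variable {d : ℕ} {β : F} {θ T : ℕ → F}

/-- A recurrent sequence with `θ (d+1) = θ 0` and `θ 1 ≠ θ d` forces `q ^ (d+1) = 1`. -/
theorem BetaRecurrent.pow_eq_one {q : F} (hq : q ≠ 0) (hq2 : q ^ 2 ≠ 1) (hβ : q + q⁻¹ = β)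
    (hθ : BetaRecurrent β (d + 1) θ) (hper : θ (d + 1) = θ 0) (hne : θ 1 ≠ θ d) :
    q ^ (d + 1) = 1 := by
  obtain ⟨a, b, c, h⟩ := hθ.exists_geometric hq hq2 hβ
  rw [h (d + 1) le_rfl, h 0 (by omega)] at hper
  rw [h 1 (by omega), h d (by omega)] at hne
  have hx : q ^ d ≠ 0 := pow_ne_zero d hq
  simp only [pow_succ, inv_pow, pow_zero] at hper hne ⊢
  generalize q ^ d = x at *
  by_contra hcon
  have hbc : b * (x * q) = c := by
    refine sub_eq_zero.1 ((mul_eq_zero.1 ?_).resolve_left (sub_ne_zero.2 hcon))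
    field_simp at hper
    linear_combination hper
  apply hne
  rw [← hbc]
  field_simp
  ring

theorem BetaRecurrent.eq_of_pow_eq_one {q : F} (hq : q ≠ 0) (hq2 : q ^ 2 ≠ 1)
    (hβ : q + q⁻¹ = β) (hd : 1 ≤ d) (hqd : q ^ (d + 1) = 1) (hT : BetaRecurrent β (d + 1) T)
    (hT0 : T 0 = 0) {i : ℕ} (hi : 1 ≤ i) (hid : i ≤ d) :
    T i = (q ^ i - 1) * (q ^ (d - i) - 1) / ((q - 1) * (q ^ (d - 1) - 1)) * T 1
      + (q ^ (i - 1) - 1) * (q ^ (d - i + 1) - 1) / ((q - 1) * (q ^ (d - 1) - 1)) * T d := by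
  obtain ⟨a, b, c, h⟩ := hT.exists_geometric hq hq2 hβ
  have hq1 : q - 1 ≠ 0 := fun e => hq2 (by linear_combination (q + 1) * e)
  have hq2' : 1 - q ^ 2 ≠ 0 := sub_ne_zero.2 hq2.symm
  have hx : q ^ i ≠ 0 := pow_ne_zero i hq
  have e1 : q ^ (d - 1) = (q ^ 2)⁻¹ := by
    refine eq_inv_of_mul_eq_one_left ?_
    rw [← pow_add, ← hqd]
    congr 1
    omega
  have e2 : q ^ (d - i + 1) = (q ^ i)⁻¹ := by
    refine eq_inv_of_mul_eq_one_left ?_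
    rw [← pow_add, ← hqd]
    congr 1
    omega
  have e3 : q ^ (d - i) = (q * q ^ i)⁻¹ := by
    refine eq_inv_of_mul_eq_one_left ?_
    rw [← pow_succ', ← pow_add, ← hqd]
    congr 1
    omega
  have e4 : q ^ (i - 1) = q ^ i / q := by
    rw [eq_div_iff hq, ← pow_succ]
    congr 1
    omega
  have e5 : q ^ d = q⁻¹ := eq_inv_of_mul_eq_one_left (by rw [← pow_succ, hqd])
  have ha : a = -b - c := by
    rw [h 0 (by omega)] at hT0
    simp only [pow_zero] at hT0
    linear_combination hT0
  rw [h i (by omega), h 1 (by omega), h d (by omega)]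
  simp only [inv_pow, e1, e2, e3, e4, e5, pow_one, ha, inv_inv]
  generalize q ^ i = x at *
  have e6 : (q ^ 2)⁻¹ - 1 = (1 - q ^ 2) / q ^ 2 := by field_simp
  rw [e6]
  field_simp
  ring

theorem BetaRecurrent.cast_eq_of_two (h2 : (2 : F) ≠ 0) (hθ : BetaRecurrent (2 : F) (d + 1) θ)
    (hper : θ (d + 1) = θ 0) (hne : θ 1 ≠ θ d) : (d : F) = -1 := by
  obtain ⟨a, b, c, h⟩ := hθ.exists_quadratic h2
  rw [h (d + 1) le_rfl, h 0 (by omega)] at hper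
  rw [h 1 (by omega), h d (by omega)] at hne
  push_cast at hper hne
  by_contra hcon
  have hb : b + c * (d + 1) = 0 := by
    refine (mul_eq_zero.1 ?_).resolve_left (fun e => hcon (eq_neg_of_add_eq_zero_left e))
    linear_combination hper
  apply hne
  linear_combination (1 - (d : F)) * hb

theorem BetaRecurrent.cast_eq_of_neg_two (h2 : (2 : F) ≠ 0) (hd : 1 ≤ d) (hodd : Odd d)
    (hθ : BetaRecurrent (-2 : F) (d + 1) θ) (hper : θ (d + 1) = θ 0) (hne : θ 0 ≠ θ 2) :
    (d : F) = -1 := by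
  obtain ⟨a, b, c, h⟩ := hθ.exists_alternating h2
  rw [h (d + 1) le_rfl, h 0 (by omega), hodd.add_one.neg_one_pow] at hper
  rw [h 0 (by omega), h 2 (by omega)] at hne
  push_cast at hper hne
  by_contra hcon
  have hc : c = 0 := by
    refine (mul_eq_zero.1 ?_).resolve_left (fun e => hcon (eq_neg_of_add_eq_zero_left e))
    linear_combination hper
  apply hne
  rw [hc]
  ring

end ClosedForms

/-- `ϑ i` as a linear combination of `ϑ 1` and `ϑ d`, in the four cases. -/
theorem stmt19 {F V : Type*} [Field F] [AddCommGroup V] [Module F V]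
    (d : ℕ) (hd : 3 ≤ d) (hdim : Module.finrank F V = d + 1)
    (β : F)
    (Φ : CHSystem F V d) (φ : ℕ → F)
    (hφ0 : ∀ i, 1 ≤ i → i ≤ d → φ i ≠ 0)
    (hsplit : SplitSeq d Φ.A Φ.As Φ.θ Φ.θs φ)
    (hrec : BetaRecurrent β d Φ.θ ∧ BetaRecurrent β d Φ.θs ∧
      BetaRecurrent β (d+1) (vth d Φ.θ Φ.θs φ)) :
    ∀ i, 1 ≤ i → i ≤ d →
      -- (i) the case β ≠ ±2
      ((β ≠ 2 → β ≠ -2 →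
        ∀ q : AlgebraicClosure F, q ≠ 0 →
          q + q⁻¹ = algebraMap F (AlgebraicClosure F) β →
          algebraMap F (AlgebraicClosure F) (vth d Φ.θ Φ.θs φ i) =
            (q^i - 1) * (q^(d-i) - 1) / ((q - 1) * (q^(d-1) - 1)) *
              algebraMap F (AlgebraicClosure F) (vth d Φ.θ Φ.θs φ 1)
            + (q^(i-1) - 1) * (q^(d-i+1) - 1) / ((q - 1) * (q^(d-1) - 1)) *
              algebraMap F (AlgebraicClosure F) (vth d Φ.θ Φ.θs φ d)) ∧
      -- (ii) the case β = 2, char F ≠ 2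
      (β = 2 → ringChar F ≠ 2 →
        vth d Φ.θ Φ.θs φ i =
          (i : F) * ((d : F) - (i : F)) / ((d : F) - 1) * vth d Φ.θ Φ.θs φ 1
          + ((i : F) - 1) * ((d : F) - (i : F) + 1) / ((d : F) - 1) * vth d Φ.θ Φ.θs φ d) ∧
      -- (iii) the case β = -2, char F ≠ 2, d odd
      (β = -2 → ringChar F ≠ 2 → Odd d →
        (Even i →
          vth d Φ.θ Φ.θs φ i =
            (i : F) / ((d : F) - 1) * vth d Φ.θ Φ.θs φ 1
            + ((d : F) - (i : F) + 1) / ((d : F) - 1) * vth d Φ.θ Φ.θs φ d) ∧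
        (Odd i →
          vth d Φ.θ Φ.θs φ i =
            ((d : F) - (i : F)) / ((d : F) - 1) * vth d Φ.θ Φ.θs φ 1
            + ((i : F) - 1) / ((d : F) - 1) * vth d Φ.θ Φ.θs φ d)) ∧
      -- (iv) the case β = 0, char F = 2, d = 3
      (β = 0 → ringChar F = 2 → d = 3 →
        vth d Φ.θ Φ.θs φ 2 = vth d Φ.θ Φ.θs φ 1 + vth d Φ.θ Φ.θs φ 3)) := by
  obtain ⟨hθ, hθs, hT⟩ := hrec
  have hext := Φ.betaRecurrent_update hd hsplit hθ hθs
  have hT0 : vth d Φ.θ Φ.θs φ 0 = 0 := by simp [vth]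
  have hper : Function.update Φ.θ (d + 1) (Φ.θ 0) (d + 1) =
      Function.update Φ.θ (d + 1) (Φ.θ 0) 0 := by simp
  have hne {k l : ℕ} (hk : k ≤ d) (hl : l ≤ d) (hkl : k ≠ l) :
      Function.update Φ.θ (d + 1) (Φ.θ 0) k ≠ Function.update Φ.θ (d + 1) (Φ.θ 0) l := by
    rw [Function.update_of_ne (by omega), Function.update_of_ne (by omega)]
    exact fun h => hkl (Φ.θ_inj k hk l hl h)
  generalize vth d Φ.θ Φ.θs φ = T at *
  generalize Function.update Φ.θ (d + 1) (Φ.θ 0) = θ at *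
  have htwo (hchar : ringChar F ≠ 2) : (2 : F) ≠ 0 := Ring.two_ne_zero hchar
  intro i hi hid
  refine ⟨?_, ?_, ?_, ?_⟩
  · intro hβ2 hβ2' q hq hqβ
    have hq2 : q ^ 2 ≠ 1 := by
      intro h
      rcases mul_self_eq_one_iff.1 ((sq q).symm.trans h) with rfl | rfl
      · refine hβ2 ((algebraMap F (AlgebraicClosure F)).injective ?_)
        rw [← hqβ, map_ofNat, inv_one]
        norm_num
      · refine hβ2' ((algebraMap F (AlgebraicClosure F)).injective ?_)
        rw [← hqβ, map_neg, map_ofNat, inv_neg, inv_one]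
        norm_num
    have inj := (algebraMap F (AlgebraicClosure F)).injective
    have hqd := (hext.map (algebraMap F (AlgebraicClosure F))).pow_eq_one hq hq2 hqβ
      (congrArg _ hper) (inj.ne (hne (k := 1) (l := d) (by omega) le_rfl (by omega)))
    exact (hT.map (algebraMap F (AlgebraicClosure F))).eq_of_pow_eq_one hq hq2 hqβ
      (by omega) hqd (by simp [hT0]) hi hid
  · rintro rfl hchar
    have h2 := htwo hchar
    have hdF := hext.cast_eq_of_two h2 hper (hne (by omega) le_rfl (by omega))
    obtain ⟨a, b, c, h⟩ := hT.exists_quadratic h2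
    rw [h 0 (by omega)] at hT0
    rw [h i (by omega), h 1 (by omega), h d (by omega), hdF,
      show (-1 - 1 : F) = -2 by ring]
    push_cast at hT0 ⊢
    field_simp
    linear_combination (2 - 2 * (i : F) ^ 2) * hT0
  · rintro rfl hchar hodd
    have h2 := htwo hchar
    have hdF := hext.cast_eq_of_neg_two h2 (by omega) hodd hper
      (hne (by omega) (by omega) (by omega))
    obtain ⟨a, b, c, h⟩ := hT.exists_alternating h2
    rw [h 0 (by omega)] at hT0
    rw [h i (by omega), h 1 (by omega), h d (by omega), hdF,
      show (-1 - 1 : F) = -2 by ring, hodd.neg_one_pow]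
    push_cast at hT0 ⊢
    constructor
    · intro hev
      rw [hev.neg_one_pow]
      field_simp
      linear_combination 2 * hT0
    · intro hod
      rw [hod.neg_one_pow]
      field_simp
      ring
  · rintro rfl - rfl
    have h := hT 2 le_rfl (by omega)
    simp only [Nat.reduceAdd, Nat.reduceSub, hT0] at h
    linear_combination h
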